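/- For all distinct robots i, j ∈ R, if x¹ ∈ χ^obs_{j≻i} and x² ∈ χ^obs_{i≻j}, then the slab {x ∈ χ : x¹_i ≤ x_i ≤ x²_i} is contained in χ^obs_{i≻j} ∪ χ^obs_{j≻i}. -/

import Mathlib

open Set

noncomputable section

/-- Canonical basis vector `e i` of the coordination space `ℝ^n`. -/
def basisVec (n : ℕ) (i : Fin n) : Fin n → ℝ := Pi.single i 1

/-- Collision cylinder `χ^obs_{ij} = {x : (x i, x j) ∈ κ i j}`. -/
def cyl (n : ℕ) (κ : Fin n → Fin n → Set (ℝ × ℝ)) (i j : Fin n) : Set (Fin n → ℝ) :=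
  {x | (x i, x j) ∈ κ i j}

/-- Completed cylinder `χ^obs_{i≻j} = χ^obs_{ij} − ℝ₊ e_i + ℝ₊ e_j` (Minkowski sums). -/
def cylPr (n : ℕ) (κ : Fin n → Fin n → Set (ℝ × ℝ)) (i j : Fin n) : Set (Fin n → ℝ) :=
  {z | ∃ y ∈ cyl n κ i j, ∃ a b : ℝ, 0 ≤ a ∧ 0 ≤ b ∧
    z = y - a • basisVec n i + b • basisVec n j}

/-- Obstacle region `χ^obs = ⋃_{i,j} χ^obs_{ij}`. -/
def obsRegion (n : ℕ) (κ : Fin n → Fin n → Set (ℝ × ℝ)) : Set (Fin n → ℝ) :=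
  ⋃ i, ⋃ j, cyl n κ i j

/-- Obstacle-free region `χ^free = χ \ χ^obs`. -/
def freeRegion (n : ℕ) (κ : Fin n → Fin n → Set (ℝ × ℝ)) : Set (Fin n → ℝ) :=
  (obsRegion n κ)ᶜ

/-- Standing hypotheses on the collision data `κ`: each `κ i j` is open, bounded and
convex, `κ i i = ∅`, and `(a,b) ∈ κ i j ↔ (b,a) ∈ κ j i`. -/
def KappaHyp (n : ℕ) (κ : Fin n → Fin n → Set (ℝ × ℝ)) : Prop :=
  (∀ i j, IsOpen (κ i j)) ∧ (∀ i j, Bornology.IsBounded (κ i j)) ∧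
  (∀ i j, Convex ℝ (κ i j)) ∧ (∀ i, κ i i = ∅) ∧
  (∀ (i j : Fin n) (a b : ℝ), (a, b) ∈ κ i j ↔ (b, a) ∈ κ j i)

/-- `PhiMem n C φ` : `φ` restricted to `[0,1]` is a continuous nondecreasing path whose
image lies in `C`, with `φ 0 − ℝ₊^n ⊆ C` and `φ 1 + ℝ₊^n ⊆ C` (the set `Φ(C)`). -/
def PhiMem (n : ℕ) (C : Set (Fin n → ℝ)) (φ : ℝ → Fin n → ℝ) : Prop :=
  ContinuousOn φ (Icc 0 1) ∧
  (∀ t1 ∈ Icc (0:ℝ) 1, ∀ t2 ∈ Icc (0:ℝ) 1, t1 ≤ t2 → φ t1 ≤ φ t2) ∧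
  (∀ t ∈ Icc (0:ℝ) 1, φ t ∈ C) ∧
  (∀ d : Fin n → ℝ, 0 ≤ d → φ 0 - d ∈ C) ∧
  (∀ d : Fin n → ℝ, 0 ≤ d → φ 1 + d ∈ C)

theorem mem_cylPr_iff {n : ℕ} {κ : Fin n → Fin n → Set (ℝ × ℝ)} {i j : Fin n} (hij : i ≠ j)
    {x : Fin n → ℝ} : x ∈ cylPr n κ i j ↔ ∃ p ∈ κ i j, x i ≤ p.1 ∧ p.2 ≤ x j := by
  constructor
  · rintro ⟨y, hy, a, b, ha, hb, rfl⟩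
    exact ⟨(y i, y j), hy, by simp [basisVec, hij, ha], by simp [basisVec, hij.symm, hb]⟩
  · rintro ⟨⟨p, q⟩, hp, hxp, hqx⟩
    refine ⟨x + (p - x i) • basisVec n i - (x j - q) • basisVec n j, ?_, p - x i, x j - q,
      sub_nonneg.2 hxp, sub_nonneg.2 hqx, by abel⟩
    simpa [cyl, basisVec, hij, hij.symm] using hp

/-- A convex subset of the plane meets every vertical line between two of its points. -/
theorem Convex.exists_mk_mem_of_fst_le {s : Set (ℝ × ℝ)} (hs : Convex ℝ s) {p q : ℝ × ℝ}
    (hp : p ∈ s) (hq : q ∈ s) {t : ℝ} (hpt : p.1 ≤ t) (htq : t ≤ q.1) : ∃ u, (t, u) ∈ s := by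
  have h : OrdConnected (Prod.fst '' s) :=
    (hs.linear_image (LinearMap.fst ℝ ℝ ℝ)).ordConnected
  obtain ⟨⟨_, u⟩, hu, rfl⟩ := h.out (mem_image_of_mem _ hp) (mem_image_of_mem _ hq) ⟨hpt, htq⟩
  exact ⟨u, hu⟩

/-- if `x¹ ∈ χ^obs_{j≻i}` and `x² ∈ χ^obs_{i≻j}`, the slab
`{x : x¹_i ≤ x_i ≤ x²_i}` is contained in `χ^obs_{i≻j} ∪ χ^obs_{j≻i}`. -/
theorem stmt3 (n : ℕ) (hn : 1 ≤ n) (κ : Fin n → Fin n → Set (ℝ × ℝ))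
    (hκ : KappaHyp n κ) (i j : Fin n) (hij : i ≠ j) (x1 x2 : Fin n → ℝ)
    (h1 : x1 ∈ cylPr n κ j i) (h2 : x2 ∈ cylPr n κ i j) :
    {x : Fin n → ℝ | x1 i ≤ x i ∧ x i ≤ x2 i} ⊆ cylPr n κ i j ∪ cylPr n κ j i := by
  obtain ⟨-, -, hconv, -, hsymm⟩ := hκ
  rintro x ⟨hx1, hx2⟩
  obtain ⟨p, hp, -, hpi⟩ := (mem_cylPr_iff hij.symm).1 h1
  obtain ⟨q, hq, hqi, -⟩ := (mem_cylPr_iff hij).1 h2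
  obtain ⟨u, hu⟩ := (hconv i j).exists_mk_mem_of_fst_le ((hsymm j i p.1 p.2).1 hp) hq
    (hpi.trans hx1) (hx2.trans hqi)
  rcases le_total u (x j) with h | h
  · exact .inl ((mem_cylPr_iff hij).2 ⟨_, hu, le_rfl, h⟩)
  · exact .inr ((mem_cylPr_iff hij.symm).2 ⟨_, (hsymm i j _ _).1 hu, h, le_rfl⟩)
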